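/- Let (Q,P) be a weakly quasi-lattice ordered group and let Λ be a P-graph with FA(Λ) ≠ ∅. Then the semigroup action (PS(Λ),P,T) is locally compact: PS(Λ) is a locally compact Hausdorff space, and for every m ∈ P, the sets D_m and R_m are open in PS(Λ) and the map T_m : D_m → R_m is a local homeomorphism. -/

import Mathlib

set_option autoImplicit false

/-- The topology on the power set `Set α` obtained by identifying it with the
product `∏ _ : α, Prop` where each (two-point) factor `Prop` carries the
discrete topology. -/
instance powersetTopology (α : Type) : TopologicalSpace (Set α) :=
  @Pi.topologicalSpace α (fun _ => Prop) (fun _ => ⊥)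

/-- The cylinder `Z(K₁;K₂) = {x : K₁ ⊆ x ⊆ K₂ᶜ}`. -/
def cylinder {α : Type} (K₁ K₂ : Set α) : Set (Set α) :=
  {x | K₁ ⊆ x ∧ x ⊆ K₂ᶜ}

/-- The relation `p ≤ r` iff `p * q = r` for some `q ∈ P`. -/
def Submonoid.leftLE {Q : Type} [Group Q] (P : Submonoid Q) (p r : Q) : Prop :=
  ∃ q ∈ P, p * q = r

/-- A weakly quasi-lattice ordered group `(Q,P)`: a group `Q` together with a
subsemigroup `P` containing the unit with `P ∩ P⁻¹ = {e}`, such that any two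
elements of `P` with a common upper bound (for `leftLE`) have a least common
upper bound. -/
structure WQLO (Q : Type) [Group Q] where
  P : Submonoid Q
  inter_inv : ∀ p ∈ P, p⁻¹ ∈ P → p = 1
  lub : ∀ a ∈ P, ∀ b ∈ P, (∃ c ∈ P, P.leftLE a c ∧ P.leftLE b c) →
    ∃ l ∈ P, P.leftLE a l ∧ P.leftLE b l ∧
      ∀ c ∈ P, P.leftLE a c → P.leftLE b c → P.leftLE l c

/-- A (discrete) `P`-graph: a countable small category, presented by its set of
morphisms `Λ` with range map `r`, source map `s` and a composition `mul`
(constrained by the axioms only on composable pairs, i.e. when `s μ = r ν`),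
together with a degree functor `d : Λ → P` satisfying the unique factorisation
property. The units of `Λ` are exactly the elements of the form `r lam`. -/
structure PGraph (Q : Type) [Group Q] (W : WQLO Q) where
  Λ : Type
  countable : Countable Λ
  r : Λ → Λ
  s : Λ → Λ
  mul : Λ → Λ → Λ
  d : Λ → Q
  d_mem : ∀ lam, d lam ∈ W.P
  s_r : ∀ lam, s (r lam) = r lam
  r_r : ∀ lam, r (r lam) = r lam
  s_s : ∀ lam, s (s lam) = s lam
  r_s : ∀ lam, r (s lam) = s lam
  id_mul : ∀ lam, mul (r lam) lam = lam
  mul_id : ∀ lam, mul lam (s lam) = lam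
  r_mul : ∀ mu nu, s mu = r nu → r (mul mu nu) = r mu
  s_mul : ∀ mu nu, s mu = r nu → s (mul mu nu) = s nu
  mul_assoc : ∀ mu nu k, s mu = r nu → s nu = r k →
    mul (mul mu nu) k = mul mu (mul nu k)
  d_unit : ∀ lam, d (r lam) = 1
  d_mul : ∀ mu nu, s mu = r nu → d (mul mu nu) = d mu * d nu
  factor : ∀ lam, ∀ p ∈ W.P, ∀ q ∈ W.P, d lam = p * q →
    ∃! mn : Λ × Λ, s mn.1 = r mn.2 ∧ mul mn.1 mn.2 = lam ∧ d mn.1 = p ∧ d mn.2 = q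

namespace PGraph

variable {Q : Type} [Group Q] {W : WQLO Q} (G : PGraph Q W)

/-- `λΛ = {λμ : μ ∈ Λ, s λ = r μ}`. -/
def cone (lam : G.Λ) : Set G.Λ :=
  {x | ∃ mu, G.s lam = G.r mu ∧ x = G.mul lam mu}

/-- `λE = {λμ : μ ∈ E, s λ = r μ}`. -/
def coneSet (lam : G.Λ) (E : Set G.Λ) : Set G.Λ :=
  {x | ∃ mu ∈ E, G.s lam = G.r mu ∧ x = G.mul lam mu}

/-- `Λ` is finitely aligned at the pair `(μ,ν)`. -/
def FinAlignedAtPair (mu nu : G.Λ) : Prop :=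
  ∃ J : Finset G.Λ, G.cone mu ∩ G.cone nu = ⋃ lam ∈ (J : Set G.Λ), G.cone lam

/-- `Λ` is finitely aligned at `λ`. -/
def FinAlignedAt (lam : G.Λ) : Prop :=
  ∀ mu ∈ G.cone lam, ∀ nu : G.Λ, G.FinAlignedAtPair mu nu

/-- The finitely aligned part `FA(Λ)`. -/
def FA : Set G.Λ := {lam | G.FinAlignedAt lam}

/-- `FAr(Λ) = FA(Λ) ∪ r(FA(Λ))`. -/
def FAr : Set G.Λ := G.FA ∪ G.r '' G.FA

/-- `μ ≼ λ` iff `μν = λ` for some `ν`. -/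
def pre (mu lam : G.Λ) : Prop :=
  ∃ nu, G.s mu = G.r nu ∧ G.mul mu nu = lam

/-- A filter: a nonempty, hereditary and directed subset of `Λ`. -/
def IsFilter (x : Set G.Λ) : Prop :=
  x.Nonempty ∧ (∀ lam mu, G.pre lam mu → mu ∈ x → lam ∈ x) ∧
    ∀ mu ∈ x, ∀ nu ∈ x, ∃ lam ∈ x, G.pre mu lam ∧ G.pre nu lam

/-- The space `ℱΛ` of filters, with the subspace topology from `𝒫(Λ)`. -/
abbrev FilterSpace := {x : Set G.Λ // G.IsFilter x}

/-- `Z_{ℱΛ}(μ;K) = {x ∈ ℱΛ : μ ∈ x ⊆ Λ∖K}`. -/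
def Zf (mu : G.Λ) (K : Set G.Λ) : Set G.FilterSpace :=
  {x | mu ∈ x.1 ∧ x.1 ⊆ Kᶜ}

/-- An ultrafilter: a filter maximal with respect to inclusion. -/
def IsUltrafilter (x : Set G.Λ) : Prop :=
  G.IsFilter x ∧ ∀ y, G.IsFilter y → x ⊆ y → x = y

/-- The path space `PS(Λ)`: filters meeting `FA(Λ)` (as a set of subsets). -/
def PS : Set (Set G.Λ) := {x | G.IsFilter x ∧ (x ∩ G.FA).Nonempty}

/-- The path space as a topological space (subspace of `𝒫(Λ)`). -/
abbrev PSpace := {x : Set G.Λ // x ∈ G.PS}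

/-- The boundary-path space: the closure in `PS(Λ)` of the set of ultrafilters
lying in `PS(Λ)`. -/
def BPS : Set G.PSpace := closure {x : G.PSpace | G.IsUltrafilter x.1}

abbrev BPSpace := {x : G.PSpace // x ∈ G.BPS}

/-- The left shift `λ⁻¹·x = {μ : λμ ∈ x}`. -/
def lshift (lam : G.Λ) (x : Set G.Λ) : Set G.Λ :=
  {mu | G.s lam = G.r mu ∧ G.mul lam mu ∈ x}

/-- The right shift `λ·x = {ζ : ζ ≼ λμ for some μ ∈ x}`. -/
def rshift (lam : G.Λ) (x : Set G.Λ) : Set G.Λ :=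
  {z | ∃ mu ∈ x, G.s lam = G.r mu ∧ G.pre z (G.mul lam mu)}

/-- The action `x·m`: the left shift of `x` by the unique element of
`x ∩ Λ^m` (when it exists). -/
def act (x : Set G.Λ) (m : Q) : Set G.Λ :=
  ⋃ lam ∈ {l ∈ x | G.d l = m}, G.lshift lam x

/-- The domain `D_m = {x ∈ PS(Λ) : x ∩ Λ^m ≠ ∅}` of `T_m`. -/
def Dom (m : Q) : Set (Set G.Λ) := {x ∈ G.PS | ∃ l ∈ x, G.d l = m}

/-- The range `R_m = {x·m : x ∈ D_m}` of `T_m`. -/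
def Ran (m : Q) : Set (Set G.Λ) := {y | ∃ x ∈ G.Dom m, G.act x m = y}

end PGraph
section PowersetTopology

theorem isClopen_setOf_mem {α : Type} (a : α) : IsClopen {x : Set α | a ∈ x} := by
  let : TopologicalSpace Prop := ⊥
  have : DiscreteTopology Prop := ⟨rfl⟩
  have h : Continuous (fun x : Set α => a ∈ x) := continuous_apply (A := fun _ : α => Prop) a
  exact (isClopen_discrete {p : Prop | p}).preimage h

theorem continuous_set_of_isClopen {α X : Type} [TopologicalSpace X] {f : X → Set α}
    (h : ∀ a, IsClopen {x | a ∈ f x}) : Continuous f := by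
  let : TopologicalSpace Prop := ⊥
  have : DiscreteTopology Prop := ⟨rfl⟩
  refine continuous_pi (A := fun _ : α => Prop) fun a => continuous_discrete_rng.2 fun b => ?_
  by_cases hb : b
  · convert (h a).isOpen using 1
    ext x
    exact ⟨fun hx => (iff_of_eq hx).2 hb, fun hx => eq_true hx |>.trans (eq_true hb).symm⟩
  · convert (h a).compl.isOpen using 1
    ext x
    exact ⟨fun hx hx' => hb ((iff_of_eq hx).1 hx'),
      fun hx => eq_false hx |>.trans (eq_false hb).symm⟩

instance compactSpace_powerset (α : Type) : CompactSpace (Set α) := by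
  let : TopologicalSpace Prop := ⊥
  exact (inferInstance : CompactSpace (α → Prop))

instance t2Space_powerset (α : Type) : T2Space (Set α) := by
  let : TopologicalSpace Prop := ⊥
  have : DiscreteTopology Prop := ⟨rfl⟩
  exact (inferInstance : T2Space (α → Prop))

end PowersetTopology

namespace PGraph

variable {Q : Type} [Group Q] {W : WQLO Q} (G : PGraph Q W)

variable {G} in
theorem mem_cone {lam mu : G.Λ} : mu ∈ G.cone lam ↔ G.pre lam mu :=
  ⟨fun ⟨a, h, e⟩ => ⟨a, h, e.symm⟩, fun ⟨a, h, e⟩ => ⟨a, h, e.symm⟩⟩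

theorem pre_refl (lam : G.Λ) : G.pre lam lam :=
  ⟨G.s lam, (G.r_s lam).symm, G.mul_id lam⟩

variable {G}

theorem pre_mul {a b : G.Λ} (h : G.s a = G.r b) : G.pre a (G.mul a b) :=
  ⟨b, h, rfl⟩

theorem pre.trans {a b c : G.Λ} (hab : G.pre a b) (hbc : G.pre b c) : G.pre a c := by
  obtain ⟨u, hu, rfl⟩ := hab
  obtain ⟨v, hv, rfl⟩ := hbc
  rw [G.s_mul _ _ hu] at hv
  exact ⟨G.mul u v, by rw [G.r_mul _ _ hv, hu], (G.mul_assoc _ _ _ hu hv).symm⟩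

theorem pre.r_eq {a b : G.Λ} (h : G.pre a b) : G.r a = G.r b := by
  obtain ⟨u, hu, rfl⟩ := h
  rw [G.r_mul _ _ hu]

theorem eq_of_mul_eq_mul {a b a' b' : G.Λ} (h : G.s a = G.r b) (h' : G.s a' = G.r b')
    (hd : G.d a = G.d a') (e : G.mul a b = G.mul a' b') : a = a' ∧ b = b' := by
  have h1 := G.d_mul a b h
  have h2 := G.d_mul a' b' h'
  have hb : G.d b = G.d b' := by
    rw [e, h2, hd] at h1
    exact (mul_left_cancel h1).symm
  have := (G.factor _ _ (G.d_mem a) _ (G.d_mem b) h1).unique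
    (y₁ := (a, b)) (y₂ := (a', b')) ⟨h, rfl, rfl, rfl⟩ ⟨h', e.symm, hd.symm, hb.symm⟩
  simpa using this

theorem mul_left_cancel' {a b c : G.Λ} (h : G.s a = G.r b) (h' : G.s a = G.r c)
    (e : G.mul a b = G.mul a c) : b = c :=
  (eq_of_mul_eq_mul h h' rfl e).2

theorem pre_mul_mul {a b c : G.Λ} (h : G.s a = G.r b) (hbc : G.pre b c) :
    G.pre (G.mul a b) (G.mul a c) := by
  obtain ⟨u, hu, rfl⟩ := hbc
  exact ⟨u, by rw [G.s_mul _ _ h, hu], G.mul_assoc _ _ _ h hu⟩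

theorem pre_of_pre_mul_mul {a b c : G.Λ} (h : G.s a = G.r b) (h' : G.s a = G.r c)
    (hbc : G.pre (G.mul a b) (G.mul a c)) : G.pre b c := by
  obtain ⟨u, hu, e⟩ := hbc
  rw [G.s_mul _ _ h] at hu
  rw [G.mul_assoc _ _ _ h hu] at e
  exact ⟨u, hu, mul_left_cancel' (by rw [G.r_mul _ _ hu, h]) h' e⟩

theorem exists_mul_eq_of_pre {a b c : G.Λ} (h : G.s a = G.r b) (hc : G.pre (G.mul a b) c) :
    ∃ v, G.s a = G.r v ∧ G.pre b v ∧ G.mul a v = c := by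
  obtain ⟨u, hu, rfl⟩ := hc
  rw [G.s_mul _ _ h] at hu
  exact ⟨G.mul b u, by rw [G.r_mul _ _ hu, h], pre_mul hu, (G.mul_assoc _ _ _ h hu).symm⟩

theorem finAlignedAtPair_iff {mu nu : G.Λ} :
    G.FinAlignedAtPair mu nu ↔ ∃ J : Finset G.Λ, (∀ k ∈ J, G.pre mu k ∧ G.pre nu k) ∧
      ∀ c, G.pre mu c → G.pre nu c → ∃ k ∈ J, G.pre k c := by
  constructor
  · rintro ⟨J, hJ⟩
    refine ⟨J, fun k hk => ?_, fun c h1 h2 => ?_⟩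
    · have : k ∈ G.cone mu ∩ G.cone nu := by
        rw [hJ]
        exact Set.mem_biUnion (Finset.mem_coe.2 hk) (mem_cone.2 (G.pre_refl k))
      exact ⟨mem_cone.1 this.1, mem_cone.1 this.2⟩
    · have : c ∈ G.cone mu ∩ G.cone nu := ⟨mem_cone.2 h1, mem_cone.2 h2⟩
      rw [hJ] at this
      simpa [mem_cone] using this
  · rintro ⟨J, h1, h2⟩
    refine ⟨J, Set.Subset.antisymm ?_ ?_⟩
    · rintro c ⟨hc1, hc2⟩
      simpa [mem_cone] using h2 c (mem_cone.1 hc1) (mem_cone.1 hc2)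
    · refine Set.iUnion₂_subset fun k hk c hc => ?_
      exact ⟨mem_cone.2 ((h1 k hk).1.trans (mem_cone.1 hc)),
        mem_cone.2 ((h1 k hk).2.trans (mem_cone.1 hc))⟩

theorem mem_FA_of_pre {a b : G.Λ} (ha : a ∈ G.FA) (h : G.pre a b) : b ∈ G.FA :=
  fun mu hmu nu => ha mu (mem_cone.2 (h.trans (mem_cone.1 hmu))) nu

theorem mem_FA_of_mul_mem_FA {a b : G.Λ} (h : G.s a = G.r b) (hab : G.mul a b ∈ G.FA) :
    b ∈ G.FA := by
  intro mu hmu nu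
  rw [mem_cone] at hmu
  have ham : G.s a = G.r mu := h.trans hmu.r_eq
  rw [finAlignedAtPair_iff]
  by_cases hr : G.r mu = G.r nu
  · have han : G.s a = G.r nu := ham.trans hr
    obtain ⟨J, hJ1, hJ2⟩ := finAlignedAtPair_iff.1
      (hab _ (mem_cone.2 (pre_mul_mul h hmu)) (G.mul a nu))
    choose! g hg1 hg2 hg3 using fun k hk => exists_mul_eq_of_pre ham (hJ1 k hk).1
    classical
    refine ⟨J.image g, fun k hk => ?_, fun c h1 h2 => ?_⟩
    · obtain ⟨j, hj, rfl⟩ := Finset.mem_image.1 hk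
      refine ⟨hg2 j hj, pre_of_pre_mul_mul han (hg1 j hj) ?_⟩
      rw [hg3 j hj]
      exact (hJ1 j hj).2
    · obtain ⟨k, hk, hkc⟩ := hJ2 _ (pre_mul_mul ham h1) (pre_mul_mul han h2)
      refine ⟨g k, Finset.mem_image_of_mem g hk,
        pre_of_pre_mul_mul (hg1 k hk) (ham.trans h1.r_eq) ?_⟩
      rwa [hg3 k hk]
  · exact ⟨∅, by simp, fun c h1 h2 => absurd (h1.r_eq.trans h2.r_eq.symm) hr⟩

theorem IsFilter.r_eq {x : Set G.Λ} (hx : G.IsFilter x) {a b : G.Λ} (ha : a ∈ x) (hb : b ∈ x) :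
    G.r a = G.r b := by
  obtain ⟨c, -, h1, h2⟩ := hx.2.2 a ha b hb
  exact h1.r_eq.trans h2.r_eq.symm

theorem IsFilter.eq_of_d_eq {x : Set G.Λ} (hx : G.IsFilter x) {a b : G.Λ} (ha : a ∈ x)
    (hb : b ∈ x) (hd : G.d a = G.d b) : a = b := by
  obtain ⟨c, -, ⟨u, hu, rfl⟩, ⟨v, hv, e⟩⟩ := hx.2.2 a ha b hb
  exact (eq_of_mul_eq_mul hu hv hd e.symm).1

theorem act_eq_lshift {x : Set G.Λ} (hx : G.IsFilter x) {lam : G.Λ} (h : lam ∈ x) :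
    G.act x (G.d lam) = G.lshift lam x := by
  apply Set.Subset.antisymm
  · refine Set.iUnion₂_subset fun l hl => ?_
    rw [hx.eq_of_d_eq hl.1 h hl.2]
  · exact Set.subset_biUnion_of_mem (u := fun l => G.lshift l x) (show _ ∧ _ from ⟨h, rfl⟩)

theorem isFilter_lshift {x : Set G.Λ} (hx : G.IsFilter x) {lam : G.Λ} (h : lam ∈ x) :
    G.IsFilter (G.lshift lam x) := by
  refine ⟨⟨G.s lam, (G.r_s lam).symm, by rwa [G.mul_id]⟩, ?_, ?_⟩
  · rintro a b hab ⟨h1, h2⟩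
    have h3 : G.s lam = G.r a := h1.trans hab.r_eq.symm
    exact ⟨h3, hx.2.1 _ _ (pre_mul_mul h3 hab) h2⟩
  · rintro a ⟨ha1, ha2⟩ b ⟨hb1, hb2⟩
    obtain ⟨c, hc, hac, hbc⟩ := hx.2.2 _ ha2 _ hb2
    obtain ⟨v, hv, hav, rfl⟩ := exists_mul_eq_of_pre ha1 hac
    exact ⟨v, ⟨hv, hc⟩, hav, pre_of_pre_mul_mul hb1 hv hbc⟩

theorem isFilter_rshift {x : Set G.Λ} (hx : G.IsFilter x) {lam mu : G.Λ} (hmu : mu ∈ x)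
    (h : G.s lam = G.r mu) : G.IsFilter (G.rshift lam x) := by
  refine ⟨⟨_, mu, hmu, h, G.pre_refl _⟩, ?_, ?_⟩
  · rintro a b hab ⟨c, hc, h1, h2⟩
    exact ⟨c, hc, h1, hab.trans h2⟩
  · rintro a ⟨c, hc, h1, h2⟩ b ⟨c', hc', h1', h2'⟩
    obtain ⟨e, he, hce, hce'⟩ := hx.2.2 _ hc _ hc'
    exact ⟨G.mul lam e, ⟨e, he, h1.trans hce.r_eq, G.pre_refl _⟩,
      h2.trans (pre_mul_mul h1 hce), h2'.trans (pre_mul_mul h1' hce')⟩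

theorem lshift_rshift {x : Set G.Λ} (hx : G.IsFilter x) {lam mu : G.Λ} (hmu : mu ∈ x)
    (h : G.s lam = G.r mu) : G.lshift lam (G.rshift lam x) = x := by
  ext a
  constructor
  · rintro ⟨h1, c, hc, h2, h3⟩
    exact hx.2.1 _ _ (pre_of_pre_mul_mul h1 h2 h3) hc
  · intro ha
    have h1 : G.s lam = G.r a := h.trans (hx.r_eq hmu ha)
    exact ⟨h1, a, ha, h1, G.pre_refl _⟩

theorem rshift_lshift {x : Set G.Λ} (hx : G.IsFilter x) {lam : G.Λ} (h : lam ∈ x) :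
    G.rshift lam (G.lshift lam x) = x := by
  ext a
  constructor
  · rintro ⟨c, ⟨-, hc⟩, -, h2⟩
    exact hx.2.1 _ _ h2 hc
  · intro ha
    obtain ⟨_, hc, ⟨u, hu, rfl⟩, h2⟩ := hx.2.2 _ h _ ha
    exact ⟨u, ⟨hu, hc⟩, hu, h2⟩

theorem exists_mul_mem_FA {x : Set G.Λ} (hx : x ∈ G.PS) {lam : G.Λ} (h : lam ∈ x) :
    ∃ mu, G.s lam = G.r mu ∧ G.mul lam mu ∈ x ∧ G.mul lam mu ∈ G.FA := by
  obtain ⟨hf, a, ha, haFA⟩ := hx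
  obtain ⟨_, hc, ⟨u, hu, rfl⟩, h2⟩ := hf.2.2 _ h _ ha
  exact ⟨u, hu, hc, mem_FA_of_pre haFA h2⟩

theorem lshift_mem_PS {x : Set G.Λ} (hx : x ∈ G.PS) {lam : G.Λ} (h : lam ∈ x) :
    G.lshift lam x ∈ G.PS := by
  obtain ⟨mu, h1, h2, h3⟩ := exists_mul_mem_FA hx h
  exact ⟨isFilter_lshift hx.1 h, mu, ⟨h1, h2⟩, mem_FA_of_mul_mem_FA h1 h3⟩

theorem rshift_mem_PS {x : Set G.Λ} (hx : G.IsFilter x) {lam mu : G.Λ} (hmu : mu ∈ x)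
    (h : G.s lam = G.r mu) (hFA : G.mul lam mu ∈ G.FA) : G.rshift lam x ∈ G.PS :=
  ⟨isFilter_rshift hx hmu h, G.mul lam mu, ⟨mu, hmu, h, G.pre_refl _⟩, hFA⟩

theorem act_rshift {x : Set G.Λ} (hx : G.IsFilter x) {lam mu : G.Λ} (hmu : mu ∈ x)
    (h : G.s lam = G.r mu) : G.act (G.rshift lam x) (G.d lam) = x := by
  rw [act_eq_lshift (isFilter_rshift hx hmu h) ⟨mu, hmu, h, pre_mul h⟩, lshift_rshift hx hmu h]

theorem rshift_mem_Dom {x : Set G.Λ} (hx : G.IsFilter x) {lam mu : G.Λ} (hmu : mu ∈ x)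
    (h : G.s lam = G.r mu) (hFA : G.mul lam mu ∈ G.FA) :
    G.rshift lam x ∈ G.Dom (G.d lam) :=
  ⟨rshift_mem_PS hx hmu h hFA, lam, ⟨mu, hmu, h, pre_mul h⟩, rfl⟩

theorem act_mem_PS {x : Set G.Λ} {m : Q} (hx : x ∈ G.Dom m) : G.act x m ∈ G.PS := by
  obtain ⟨hx, lam, hl, rfl⟩ := hx
  rw [act_eq_lshift hx.1 hl]
  exact lshift_mem_PS hx hl

/-- The filters containing a finitely aligned path form a compact subset of the power set. -/
theorem isCompact_filters_mem {lam : G.Λ} (h : lam ∈ G.FA) :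
    IsCompact {x : Set G.Λ | G.IsFilter x ∧ lam ∈ x} := by
  have key : ∀ mu nu : G.Λ, G.pre lam mu → ∃ J : Finset G.Λ,
      (∀ k ∈ J, G.pre mu k ∧ G.pre nu k) ∧
      ∀ c, G.pre mu c → G.pre nu c → ∃ k ∈ J, G.pre k c :=
    fun mu nu hmu => finAlignedAtPair_iff.1 (h mu (mem_cone.2 hmu) nu)
  choose! J hJ1 hJ2 using key
  have heq : {x : Set G.Λ | G.IsFilter x ∧ lam ∈ x} =
      {x | lam ∈ x} ∩ (⋂ a, ⋂ b, ⋂ (_ : G.pre a b), {x | b ∈ x}ᶜ ∪ {x | a ∈ x}) ∩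
      ⋂ a, ⋂ b, ⋂ (_ : G.pre lam a),
        ({x | a ∈ x}ᶜ ∪ {x | b ∈ x}ᶜ) ∪ ⋃ k ∈ J a b, {x | k ∈ x} := by
    ext x
    simp only [Set.mem_inter_iff, Set.mem_iInter, Set.mem_union, Set.mem_compl_iff,
      Set.mem_ofPred_eq, Set.mem_iUnion, exists_prop]
    constructor
    · rintro ⟨hx, hl⟩
      refine ⟨⟨hl, fun a b hab => ?_⟩, fun a b ha => ?_⟩
      · have := hx.2.1 a b hab
        tauto
      · by_cases h1 : a ∈ x
        · by_cases h2 : b ∈ x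
          · obtain ⟨c, hc, hac, hbc⟩ := hx.2.2 a h1 b h2
            obtain ⟨k, hk, hkc⟩ := hJ2 a b ha c hac hbc
            exact Or.inr ⟨k, hk, hx.2.1 _ _ hkc hc⟩
          · exact Or.inl (Or.inr h2)
        · exact Or.inl (Or.inl h1)
    · rintro ⟨⟨hl, hher⟩, hdir⟩
      have dir : ∀ a ∈ x, G.pre lam a → ∀ b ∈ x, ∃ k ∈ x, G.pre a k ∧ G.pre b k := by
        intro a ha hla b hb
        obtain (h1 | h1) | ⟨k, hk, hkx⟩ := hdir a b hla
        · exact absurd ha h1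
        · exact absurd hb h1
        · exact ⟨k, hkx, hJ1 a b hla k hk⟩
      refine ⟨⟨⟨lam, hl⟩, fun a b hab hb => ?_, fun a ha b hb => ?_⟩, hl⟩
      · have := hher a b hab
        tauto
      · obtain ⟨c, hc, hlc, hac⟩ := dir lam hl (G.pre_refl lam) a ha
        obtain ⟨k, hk, hck, hbk⟩ := dir c hc hlc b hb
        exact ⟨k, hk, hac.trans hck, hbk⟩
  rw [heq]
  refine IsClosed.isCompact (IsClosed.inter (IsClosed.inter (isClopen_setOf_mem _).isClosed ?_) ?_)
  · exact isClosed_iInter fun a => isClosed_iInter fun b => isClosed_iInter fun _ =>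
      (isClopen_setOf_mem b).compl.isClosed.union (isClopen_setOf_mem a).isClosed
  · exact isClosed_iInter fun a => isClosed_iInter fun b => isClosed_iInter fun _ =>
      ((isClopen_setOf_mem a).compl.isClosed.union (isClopen_setOf_mem b).compl.isClosed).union
        ((J a b).finite_toSet.isClosed_biUnion fun k _ => (isClopen_setOf_mem k).isClosed)

theorem isClopen_mem_PSpace (a : G.Λ) : IsClopen {x : G.PSpace | a ∈ x.1} :=
  (isClopen_setOf_mem a).preimage continuous_subtype_val

theorem isCompact_mem_PSpace {a : G.Λ} (ha : a ∈ G.FA) : IsCompact {x : G.PSpace | a ∈ x.1} := by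
  rw [Subtype.isCompact_iff]
  convert isCompact_filters_mem ha using 1
  ext x
  constructor
  · rintro ⟨y, hy, rfl⟩
    exact ⟨y.2.1, hy⟩
  · rintro ⟨hx, hax⟩
    exact ⟨⟨x, hx, a, hax, ha⟩, hax, rfl⟩

theorem locallyCompactSpace_PSpace (G : PGraph Q W) : LocallyCompactSpace G.PSpace := by
  have : WeaklyLocallyCompactSpace G.PSpace := ⟨fun x => by
    obtain ⟨a, hax, ha⟩ := x.2.2
    exact ⟨_, isCompact_mem_PSpace ha, (isClopen_mem_PSpace a).isOpen.mem_nhds hax⟩⟩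
  infer_instance

theorem isOpen_Dom (G : PGraph Q W) (m : Q) : IsOpen {x : G.PSpace | x.1 ∈ G.Dom m} := by
  refine isOpen_iff_mem_nhds.2 fun x hx => ?_
  obtain ⟨-, l, hl, hd⟩ := hx
  exact Filter.mem_of_superset ((isClopen_mem_PSpace l).isOpen.mem_nhds hl)
    fun y hy => ⟨y.2, l, hy, hd⟩

theorem isOpen_Ran (G : PGraph Q W) (m : Q) : IsOpen {y : G.PSpace | y.1 ∈ G.Ran m} := by
  refine isOpen_iff_mem_nhds.2 fun y hy => ?_
  obtain ⟨x, ⟨hx, lam, hl, rfl⟩, hxy⟩ := hy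
  rw [act_eq_lshift hx.1 hl] at hxy
  obtain ⟨mu, h1, h2, h3⟩ := exists_mul_mem_FA hx hl
  have hmu : mu ∈ y.1 := hxy ▸ ⟨h1, h2⟩
  exact Filter.mem_of_superset ((isClopen_mem_PSpace mu).isOpen.mem_nhds hmu)
    fun z hz => ⟨_, rshift_mem_Dom z.2.1 hz h1 h3, act_rshift z.2.1 hz h1⟩

/-- The map `T_m : D_m → R_m`. -/
def shiftMap (G : PGraph Q W) (m : Q) (x : {x : G.PSpace // x.1 ∈ G.Dom m}) :
    {y : G.PSpace // y.1 ∈ G.Ran m} :=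
  ⟨⟨G.act x.1.1 m, act_mem_PS x.2⟩, x.1.1, x.2, rfl⟩

theorem isLocalHomeomorph_shiftMap (G : PGraph Q W) (m : Q) :
    IsLocalHomeomorph (G.shiftMap m) := by
  rw [isLocalHomeomorph_iff_isOpenEmbedding_restrict]
  intro x
  obtain ⟨hx, lam, hl, rfl⟩ := x.2
  obtain ⟨mu, h1, h2, h3⟩ := exists_mul_mem_FA hx hl
  set U : Set {x : G.PSpace // x.1 ∈ G.Dom (G.d lam)} := {z | G.mul lam mu ∈ z.1.1}
  have hlam : ∀ z ∈ U, lam ∈ z.1.1 := fun z hz => z.1.2.1.2.1 _ _ (pre_mul h1) hz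
  have hact : ∀ z ∈ U, (G.shiftMap _ z).1.1 = G.lshift lam z.1.1 := fun z hz =>
    act_eq_lshift z.1.2.1 (hlam z hz)
  have hUo : IsOpen U := (isClopen_mem_PSpace _).isOpen.preimage continuous_subtype_val
  have hUc : IsCompact U := by
    rw [Subtype.isCompact_iff]
    convert isCompact_mem_PSpace h3 using 1
    ext z
    constructor
    · rintro ⟨w, hw, rfl⟩
      exact hw
    · intro hz
      exact ⟨⟨z, z.2, lam, z.2.1.2.1 _ _ (pre_mul h1) hz, rfl⟩, hz, rfl⟩
  have hcont : Continuous (U.domRestrict (G.shiftMap (G.d lam))) := by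
    refine Continuous.subtype_mk (Continuous.subtype_mk ?_ _) _
    refine continuous_set_of_isClopen fun a => ?_
    by_cases ha : G.s lam = G.r a
    · convert (isClopen_mem_PSpace (G.mul lam a)).preimage
        (continuous_subtype_val.comp (continuous_subtype_val (p := (· ∈ U)))) using 1
      ext z
      refine (Set.ext_iff.1 (hact z.1 z.2) a).trans ?_
      exact ⟨fun h => h.2, fun h => ⟨ha, h⟩⟩
    · convert isClopen_empty using 1
      ext z
      refine (Set.ext_iff.1 (hact z.1 z.2) a).trans ?_
      exact ⟨fun h => ha h.1, fun h => h.elim⟩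
  have hinj : Function.Injective (U.domRestrict (G.shiftMap (G.d lam))) := by
    intro z w hzw
    have h : G.lshift lam z.1.1.1 = G.lshift lam w.1.1.1 := by
      rw [← hact z.1 z.2, ← hact w.1 w.2]
      exact congrArg (fun y => y.1.1) hzw
    have h' := congrArg (G.rshift lam) h
    rw [rshift_lshift z.1.1.2.1 (hlam z.1 z.2), rshift_lshift w.1.1.2.1 (hlam w.1 w.2)] at h'
    exact Subtype.ext (Subtype.ext (Subtype.ext h'))
  refine ⟨U, hUo.mem_nhds h2, ?_⟩
  have : CompactSpace U := isCompact_iff_compactSpace.1 hUc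
  refine ⟨(hcont.isClosedEmbedding hinj).isEmbedding, ?_⟩
  convert (isClopen_mem_PSpace mu).isOpen.preimage
    (continuous_subtype_val (p := fun y : G.PSpace => y.1 ∈ G.Ran (G.d lam))) using 1
  ext y
  constructor
  · rintro ⟨z, rfl⟩
    exact (Set.ext_iff.1 (hact z.1 z.2) mu).2 ⟨h1, z.2⟩
  · intro hy
    have hD := rshift_mem_Dom y.1.2.1 hy h1 h3
    exact ⟨⟨⟨⟨_, hD.1⟩, hD⟩, mu, hy, h1, G.pre_refl _⟩,
      Subtype.ext (Subtype.ext (act_rshift y.1.2.1 hy h1))⟩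

end PGraph

/-- The semigroup action `(PS(Λ), P, T)` is locally compact: `PS(Λ)` is a
locally compact Hausdorff space, and for every `m ∈ P` the sets `D_m` and
`R_m` are open in `PS(Λ)` and `T_m : D_m → R_m` is a local homeomorphism. -/
theorem statement16 {Q : Type} [Group Q] {W : WQLO Q} (G : PGraph Q W)
    (hne : G.FA.Nonempty) :
    LocallyCompactSpace G.PSpace ∧ T2Space G.PSpace ∧
    ∀ m ∈ W.P,
      IsOpen {x : G.PSpace | x.1 ∈ G.Dom m} ∧
      IsOpen {y : G.PSpace | y.1 ∈ G.Ran m} ∧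
      ∃ f : {x : G.PSpace // x.1 ∈ G.Dom m} → {y : G.PSpace // y.1 ∈ G.Ran m},
        (∀ x, (f x).1.1 = G.act x.1.1 m) ∧ IsLocalHomeomorph f := by
  exact ⟨G.locallyCompactSpace_PSpace, inferInstance, fun m _ => ⟨G.isOpen_Dom m, G.isOpen_Ran m,
    G.shiftMap m, fun _ => rfl, G.isLocalHomeomorph_shiftMap m⟩⟩
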